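/- arXiv:2108.09095 — 2 statements merged into one kernel-verified Lean document; each statement's English description precedes it below -/
import Mathlib

section
/- Let α ≥ 0 be a real number and let G be a simple graph on n vertices with matching number β. If 2β + 2 ≤ n < ((2α+3)β + α + 2)/(α+1), then ρ_α(G) ≤ 2(α+1)β, with equality if and only if G is isomorphic to the disjoint union K_{2β+1} ∪ K̄_{n−2β−1}. -/
open scoped Classical

/-- The adjacency matrix of a graph, over ℝ. -/
noncomputable def adjMat {V : Type*} [Fintype V] (G : SimpleGraph V) : Matrix V V ℝ :=
  fun i j => if G.Adj i j then 1 else 0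

/-- The diagonal matrix of vertex degrees, over ℝ. -/
noncomputable def degMat {V : Type*} [Fintype V] (G : SimpleGraph V) : Matrix V V ℝ :=
  fun i j => if i = j then ((G.neighborSet i).ncard : ℝ) else 0

/-- The largest (real) eigenvalue of a matrix. -/
noncomputable def specRad {V : Type*} [Fintype V] (M : Matrix V V ℝ) : ℝ :=
  sSup {t : ℝ | ∃ v : V → ℝ, v ≠ 0 ∧ M.mulVec v = t • v}

/-- The α-spectral radius: the largest eigenvalue of A_α(G) = α·D(G) + A(G). -/
noncomputable def alphaRadius {V : Type*} [Fintype V] (α : ℝ) (G : SimpleGraph V) : ℝ :=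
  specRad (α • degMat G + adjMat G)

/-- The matching number of a graph. -/
noncomputable def matchingNumber {V : Type*} [Fintype V] (G : SimpleGraph V) : ℕ :=
  sSup {m : ℕ | ∃ M : G.Subgraph, M.IsMatching ∧ M.edgeSet.ncard = m}

/-- The join of two graphs. -/
def graphJoin {A B : Type*} (G : SimpleGraph A) (H : SimpleGraph B) : SimpleGraph (A ⊕ B) :=
  SimpleGraph.fromRel (fun x y => match x, y with
    | Sum.inl a, Sum.inl b => G.Adj a b
    | Sum.inr a, Sum.inr b => H.Adj a b
    | _, _ => True)

/-- The disjoint union of two graphs. -/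
def graphSum {A B : Type*} (G : SimpleGraph A) (H : SimpleGraph B) : SimpleGraph (A ⊕ B) :=
  SimpleGraph.fromRel (fun x y => match x, y with
    | Sum.inl a, Sum.inl b => G.Adj a b
    | Sum.inr a, Sum.inr b => H.Adj a b
    | _, _ => False)

/-- The number of odd components of G − S. -/
noncomputable def oddComponentsOutside {V : Type*} [Fintype V] (G : SimpleGraph V) (S : Set V) : ℕ :=
  Set.ncard {c : (G.induce Sᶜ).ConnectedComponent | Odd c.supp.ncard}

/-- The disjoint union of cliques K_{f 0} ∪ ⋯ ∪ K_{f (q-1)}. -/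
def cliquesUnion (q : ℕ) (f : Fin q → ℕ) : SimpleGraph (Σ i : Fin q, Fin (f i)) :=
  SimpleGraph.fromRel (fun x y => x.1 = y.1)

universe u

theorem SimpleGraph.Subgraph.IsMatching.ncard_verts_le {V : Type*} [Fintype V]
    {G : SimpleGraph V} {M : G.Subgraph} (hM : M.IsMatching) :
    M.verts.ncard ≤ 2 * M.edgeSet.ncard := by
  have hedges : M.edgeSet.ncard = M.spanningCoe.edgeFinset.card := by
    rw [← SimpleGraph.Subgraph.edgeSet_spanningCoe, ← SimpleGraph.coe_edgeFinset,
      Set.ncard_coe_finset]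
  rw [hedges, ← SimpleGraph.sum_degrees_eq_twice_card_edges, Set.ncard_eq_toFinset_card',
    Finset.card_eq_sum_ones]
  refine (Finset.sum_le_sum fun v hv => ?_).trans
    (Finset.sum_le_sum_of_subset (Finset.subset_univ _))
  obtain ⟨w, hw, -⟩ := hM (Set.mem_toFinset.1 hv)
  exact (SimpleGraph.degree_pos_iff_exists_adj _ _).2 ⟨w, by simpa using hw⟩

theorem ncard_edgeSet_le_matchingNumber {V : Type*} [Fintype V] {G : SimpleGraph V}
    {M : G.Subgraph} (hM : M.IsMatching) : M.edgeSet.ncard ≤ matchingNumber G := by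
  refine le_csSup ⟨Nat.card (Sym2 V), ?_⟩ ⟨M, hM, rfl⟩
  rintro _ ⟨M', -, rfl⟩
  exact (Set.ncard_le_ncard (Set.subset_univ _)).trans (Set.ncard_univ _).le

section Join

variable {A B : Type*} {G : SimpleGraph A} {H : SimpleGraph B}

@[simp] theorem graphJoin_adj_inl_inl {a b : A} :
    (graphJoin G H).Adj (Sum.inl a) (Sum.inl b) ↔ G.Adj a b := by
  simp only [graphJoin, SimpleGraph.fromRel_adj]
  grind [G.adj_comm, G.ne_of_adj]

@[simp] theorem graphJoin_adj_inr_inr {a b : B} :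
    (graphJoin G H).Adj (Sum.inr a) (Sum.inr b) ↔ H.Adj a b := by
  simp only [graphJoin, SimpleGraph.fromRel_adj]
  grind [H.adj_comm, H.ne_of_adj]

theorem graphJoin_adj_inr_inl (a : A) (b : B) :
    (graphJoin G H).Adj (Sum.inr b) (Sum.inl a) := by
  simp [graphJoin, SimpleGraph.fromRel_adj]

end Join

/-- A perfect matching of the join of `G` with `d` further vertices restricts to a matching of `G`
that misses at most `d` vertices. -/
theorem card_le_of_isPerfectMatching_graphJoin {V : Type*} [Fintype V] {G : SimpleGraph V} {d : ℕ}
    {H : SimpleGraph (Fin d)} {M : (graphJoin G H).Subgraph} (hM : M.IsPerfectMatching) :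
    Fintype.card V ≤ 2 * matchingNumber G + d := by
  rw [SimpleGraph.Subgraph.isPerfectMatching_iff] at hM
  let N : G.Subgraph :=
    { verts := {v | ∃ w, M.Adj (Sum.inl v) (Sum.inl w)}
      Adj := fun v w => M.Adj (Sum.inl v) (Sum.inl w)
      adj_sub := fun h => graphJoin_adj_inl_inl.1 h.adj_sub
      edge_vert := fun h => ⟨_, h⟩
      symm := ⟨fun _ _ h => h.symm⟩ }
  have hN : N.IsMatching := by
    rintro v ⟨w, hw⟩
    exact ⟨w, hw, fun w' hw' => Sum.inl_injective ((hM _).unique hw' hw)⟩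
  have hcompl : N.vertsᶜ.ncard ≤ d := by
    have hex : ∀ v : ↥N.vertsᶜ, ∃ i, M.Adj (Sum.inl v.1) (Sum.inr i) := by
      rintro ⟨v, hv⟩
      obtain ⟨w | i, hw, -⟩ := hM (Sum.inl v)
      · exact absurd ⟨w, hw⟩ hv
      · exact ⟨i, hw⟩
    choose g hg using hex
    have hinj : Function.Injective g := fun v w hvw =>
      Subtype.ext (Sum.inl_injective ((hM _).unique (hg v).symm (hvw ▸ (hg w).symm)))
    rw [← Nat.card_coe_set_eq]
    exact (Nat.card_le_card_of_injective g hinj).trans (Nat.card_fin d).le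
  have h1 := hN.ncard_verts_le
  have h2 := ncard_edgeSet_le_matchingNumber hN
  have h3 := Set.ncard_add_ncard_compl N.verts
  rw [Nat.card_eq_fintype_card] at h3
  omega

theorem exists_barrier {V : Type u} [Fintype V] (G : SimpleGraph V)
    (h : 2 * matchingNumber G + 2 ≤ Fintype.card V) :
    ∃ (S : Finset V) (ι : Type u) (f : V → ι),
      (∀ x y, x ∉ S → y ∉ S → G.Adj x y → f x = f y) ∧
        Fintype.card V + S.card ≤ 2 * matchingNumber G + (Sᶜ.image f).card := by
  obtain ⟨d, hd⟩ := Nat.exists_eq_add_of_le h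
  let H := graphJoin G (⊤ : SimpleGraph (Fin d))
  obtain ⟨u, hu⟩ : ∃ u, H.IsTutteViolator u := by
    by_contra! hno
    obtain ⟨M, hM⟩ := SimpleGraph.tutte.2 hno
    have := card_le_of_isPerfectMatching_graphJoin hM
    omega
  unfold SimpleGraph.IsTutteViolator at hu
  set L := (⊤ : H.Subgraph).deleteVerts u with hL
  have hmem : ∀ x, x ∈ L.verts ↔ x ∉ u := by simp [hL]
  have hadj : ∀ x y (hx : x ∈ L.verts) (hy : y ∈ L.verts), H.Adj x y →
      L.coe.connectedComponentMk ⟨x, hx⟩ = L.coe.connectedComponentMk ⟨y, hy⟩ := by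
    intro x y hx hy hxy
    refine SimpleGraph.ConnectedComponent.connectedComponentMk_eq_of_adj ?_
    have h1 := (hmem x).1 hx
    have h2 := (hmem y).1 hy
    simp [hL, h1, h2, hxy]
  have hgap : u.ncard + 2 ≤ L.coe.oddComponents.ncard := by
    have h1 := SimpleGraph.odd_ncard_oddComponents L.coe
    have h2 : Nat.card L.verts + u.ncard = Fintype.card V + d := by
      have h3 := Set.ncard_add_ncard_compl u
      have h4 : L.verts = uᶜ := by ext x; simp [hmem]
      rw [h4, Nat.card_coe_set_eq, add_comm, h3]
      simp
    grind
  have hinr : ∀ i, Sum.inr i ∈ u := by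
    intro i
    by_contra hi
    have h1 : L.coe.oddComponents.ncard ≤ 1 := by
      suffices hall : ∀ c, c = L.coe.connectedComponentMk ⟨Sum.inr i, (hmem _).2 hi⟩ from
        (Set.ncard_le_one (Set.toFinite _)).2 fun a _ b _ => (hall a).trans (hall b).symm
      intro c
      induction c using SimpleGraph.ConnectedComponent.ind with | _ x
      obtain ⟨x | j, hx⟩ := x
      · exact (hadj _ _ _ _ (graphJoin_adj_inr_inl _ _)).symm
      · by_cases hij : i = j
        · subst hij; rfl
        · exact (hadj _ _ _ _ (graphJoin_adj_inr_inr.2 (by simpa using hij))).symm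
    omega
  let f : V → Option L.coe.ConnectedComponent := fun x =>
    if hx : Sum.inl x ∈ L.verts then some (L.coe.connectedComponentMk ⟨_, hx⟩) else none
  refine ⟨Finset.univ.filter fun x => Sum.inl x ∈ u, _, f, ?_, ?_⟩
  · intro x y hx hy hxy
    have hx' := (hmem (Sum.inl x)).2 (by simpa using hx)
    have hy' := (hmem (Sum.inl y)).2 (by simpa using hy)
    simp only [f, dif_pos hx', dif_pos hy']
    rw [hadj _ _ hx' hy' (graphJoin_adj_inl_inl.2 hxy)]
  · have h1 : u.ncard = (Finset.univ.filter fun x : V => Sum.inl x ∈ u).card + d := by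
      have : u = ((Finset.univ.filter fun x : V => Sum.inl x ∈ u).disjSum
          (Finset.univ : Finset (Fin d)) : Finset _) := by
        ext (x | i) <;> simp [hinr]
      rw [this, Set.ncard_coe_finset, Finset.card_disjSum]
      simp
    have h2 : L.coe.oddComponents.ncard ≤
        ((Finset.univ.filter fun x : V => Sum.inl x ∈ u)ᶜ.image f).card := by
      rw [← Set.ncard_coe_finset]
      refine Set.ncard_le_ncard_of_injOn some (fun c _ => ?_) (Option.some_injective _).injOn
      induction c using SimpleGraph.ConnectedComponent.ind with | _ x
      obtain ⟨x | j, hx⟩ := x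
      · have hx' := (hmem _).1 hx
        simp only [Finset.coe_image, Set.mem_image]
        exact ⟨x, by simpa using hx', by simp [f, hx]⟩
      · exact absurd (hinr j) ((hmem _).1 hx)
    have h3 : Fintype.card V + (Finset.univ.filter fun x : V => Sum.inl x ∈ u).card ≤
        2 * matchingNumber G +
          ((Finset.univ.filter fun x : V => Sum.inl x ∈ u)ᶜ.image f).card := by
      omega
    convert h3

section Spectral

variable {V : Type*} [Fintype V] {G : SimpleGraph V} {α : ℝ}

theorem alphaMat_mulVec (α : ℝ) (G : SimpleGraph V) (v : V → ℝ) (x : V) :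
    (α • degMat G + adjMat G).mulVec v x =
      α * G.degree x * v x + ∑ y ∈ G.neighborFinset x, v y := by
  have hdeg : ((G.neighborSet x).ncard : ℝ) = G.degree x := by
    rw [Set.ncard_eq_toFinset_card', SimpleGraph.degree, SimpleGraph.neighborFinset]
  have hnbr : G.neighborFinset x = Finset.univ.filter (G.Adj x) := by
    ext; simp
  simp [Matrix.mulVec, dotProduct, degMat, adjMat, add_mul, Finset.sum_add_distrib, hdeg, hnbr,
    Finset.sum_filter]

theorem finite_eigenvalues (M : Matrix V V ℝ) :
    {t : ℝ | ∃ v : V → ℝ, v ≠ 0 ∧ M.mulVec v = t • v}.Finite := by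
  refine (Module.End.finite_hasEigenvalue (Matrix.mulVecLin M)).subset ?_
  rintro t ⟨v, hv, h⟩
  exact Module.End.hasEigenvalue_of_hasEigenvector
    (Module.End.hasEigenvector_iff.2 ⟨Module.End.mem_eigenspace_iff.2 h, hv⟩)

theorem le_specRad {M : Matrix V V ℝ} {t : ℝ} {v : V → ℝ} (hv : v ≠ 0)
    (h : M.mulVec v = t • v) : t ≤ specRad M :=
  le_csSup (finite_eigenvalues M).bddAbove ⟨v, hv, h⟩

theorem exists_mulVec_eq_specRad_smul {M : Matrix V V ℝ} (h : specRad M ≠ 0) :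
    ∃ v : V → ℝ, v ≠ 0 ∧ M.mulVec v = specRad M • v := by
  refine Set.Nonempty.csSup_mem (Set.nonempty_iff_ne_empty.2 fun he => h ?_) (finite_eigenvalues M)
  simp [specRad, he]

/-- Collatz–Wielandt: an eigenvalue is at most the growth of a positive test vector at some
vertex. -/
theorem exists_le_of_eigenvalue (hα : 0 ≤ α) {t : ℝ} {v : V → ℝ} (hv : v ≠ 0)
    (hvt : (α • degMat G + adjMat G).mulVec v = t • v) {y : V → ℝ} (hy : ∀ x, 0 < y x) :
    ∃ x, t * y x ≤ α * G.degree x * y x + ∑ z ∈ G.neighborFinset x, y z := by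
  obtain ⟨w, hw⟩ := Function.ne_iff.1 hv
  obtain ⟨x, -, hx⟩ := Finset.exists_max_image Finset.univ (fun x => |v x| / y x) ⟨w, by simp⟩
  have hk : 0 < |v x| / y x :=
    (div_pos (abs_pos.2 hw) (hy w)).trans_le (hx w (Finset.mem_univ _))
  set k := |v x| / y x with hk_def
  have hle : ∀ z, |v z| ≤ k * y z := fun z => (div_le_iff₀ (hy z)).1 (hx z (Finset.mem_univ _))
  have heq : |v x| = k * y x := by rw [hk_def, div_mul_cancel₀ _ (hy x).ne']
  have h1 := congrFun hvt x
  rw [alphaMat_mulVec, Pi.smul_apply, smul_eq_mul] at h1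
  have h2 : |t * v x| ≤ α * G.degree x * (k * y x) + k * ∑ z ∈ G.neighborFinset x, y z := by
    rw [← h1, Finset.mul_sum, ← heq]
    refine (abs_add_le _ _).trans (add_le_add ?_ ?_)
    · rw [abs_mul, abs_of_nonneg (by positivity : 0 ≤ α * G.degree x)]
    · exact (Finset.abs_sum_le_sum_abs _ _).trans (Finset.sum_le_sum fun z _ => hle z)
  refine ⟨x, le_of_mul_le_mul_left ?_ hk⟩
  calc k * (t * y x) = t * |v x| := by rw [heq]; ring
    _ ≤ |t * v x| := by rw [abs_mul]; gcongr; exact le_abs_self t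
    _ ≤ _ := h2
    _ = _ := by ring

theorem alphaRadius_le (hα : 0 ≤ α) {r : ℝ} (hr : 0 ≤ r) {y : V → ℝ} (hy : ∀ x, 0 < y x)
    (h : ∀ x, α * G.degree x * y x + ∑ z ∈ G.neighborFinset x, y z ≤ r * y x) :
    alphaRadius α G ≤ r := by
  refine Real.sSup_le ?_ hr
  rintro t ⟨v, hv, hvt⟩
  obtain ⟨x, hx⟩ := exists_le_of_eigenvalue hα hv hvt hy
  exact le_of_mul_le_mul_right (hx.trans (h x)) (hy x)

theorem alphaRadius_lt (hα : 0 ≤ α) {r : ℝ} (hr : 0 < r) {y : V → ℝ} (hy : ∀ x, 0 < y x)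
    (h : ∀ x, α * G.degree x * y x + ∑ z ∈ G.neighborFinset x, y z < r * y x) :
    alphaRadius α G < r := by
  by_contra! hle
  obtain ⟨v, hv, hvt⟩ := exists_mulVec_eq_specRad_smul (hr.trans_le hle).ne'
  obtain ⟨x, hx⟩ := exists_le_of_eigenvalue hα hv hvt hy
  have := mul_le_mul_of_nonneg_right hle (hy x).le
  exact absurd (hx.trans_lt (h x)) this.not_gt

/-- If all degrees are at most `k` and `(α + 1) * k` is an eigenvalue of `A_α(G)`, then some fibre
of the eigenvector is a nonempty set of vertices of degree `k`, closed under adjacency. -/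
theorem exists_regular_closed_finset (hα : 0 ≤ α) {k : ℕ} (hdeg : ∀ x, G.degree x ≤ k)
    {v : V → ℝ} (hv : v ≠ 0)
    (hvt : (α • degMat G + adjMat G).mulVec v = ((α + 1) * k) • v) :
    ∃ C : Finset V, C.Nonempty ∧ (∀ x ∈ C, G.degree x = k) ∧ ∀ x ∈ C, ∀ y, G.Adj x y → y ∈ C := by
  obtain ⟨w, hw⟩ := Function.ne_iff.1 hv
  wlog hpos : 0 < v w generalizing v
  · refine this (v := -v) (neg_ne_zero.2 hv) (by rw [Matrix.mulVec_neg, hvt, smul_neg])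
      (by simpa using hw) ?_
    have : v w ≠ 0 := hw
    simpa using lt_of_le_of_ne (not_lt.1 hpos) this
  obtain ⟨m, -, hm⟩ := Finset.exists_max_image Finset.univ v ⟨w, by simp⟩
  have hm' : ∀ x, v x ≤ v m := fun x => hm x (Finset.mem_univ _)
  have hmpos : 0 < v m := hpos.trans_le (hm' w)
  have key : ∀ x, v x = v m → G.degree x = k ∧ ∀ y, G.Adj x y → v y = v m := by
    intro x hx
    have h1 := congrFun hvt x
    rw [alphaMat_mulVec, Pi.smul_apply, smul_eq_mul, hx] at h1
    have hsum : ∑ y ∈ G.neighborFinset x, (v m - v y) =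
        G.degree x * v m - ∑ y ∈ G.neighborFinset x, v y := by
      simp [Finset.sum_sub_distrib]
    have hnn : ∀ y ∈ G.neighborFinset x, 0 ≤ v m - v y := fun y _ => sub_nonneg.2 (hm' y)
    have hnonneg := Finset.sum_nonneg hnn
    have hdk : (G.degree x : ℝ) ≤ k := by exact_mod_cast hdeg x
    have hprod : 0 ≤ (α + 1) * ((k - G.degree x) * v m) :=
      mul_nonneg (by linarith) (mul_nonneg (by linarith) hmpos.le)
    have hs0 : ∑ y ∈ G.neighborFinset x, (v m - v y) = 0 := by nlinarith
    have hp0 : (α + 1) * ((k - G.degree x) * v m) = 0 := by nlinarith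
    constructor
    · have : (k : ℝ) - G.degree x = 0 := by
        have h3 : α + 1 ≠ 0 := by positivity
        simpa [h3, hmpos.ne'] using hp0
      exact_mod_cast (sub_eq_zero.1 this).symm
    · intro y hy
      have := (Finset.sum_eq_zero_iff_of_nonneg hnn).1 hs0 y (by simpa using hy)
      linarith
  exact ⟨Finset.univ.filter fun x => v x = v m, ⟨m, by simp⟩,
    fun x hx => (key x (by simpa using hx)).1,
    fun x hx y hxy => by simpa using (key x (by simpa using hx)).2 y hxy⟩

end Spectral

section Fibres

variable {V ι : Type*} (T : Finset V) (f : V → ι) (a : ι)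

theorem card_image_le_card_filter_ne :
    (T.image f).card ≤ ((T.filter fun x => f x ≠ a).image f).card + 1 := by
  refine (Finset.card_le_card (t := insert a ((T.filter fun x => f x ≠ a).image f)) ?_).trans
    (Finset.card_insert_le _ _)
  intro b hb
  obtain ⟨x, hx, rfl⟩ := Finset.mem_image.1 hb
  by_cases h : f x = a
  · simp [h]
  · exact Finset.mem_insert_of_mem (Finset.mem_image_of_mem f (by simp [hx, h]))

theorem card_fibre_add_card_image_le :
    (T.filter fun x => f x = a).card + (T.image f).card ≤ T.card + 1 := by
  have h1 := card_image_le_card_filter_ne T f a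
  have h2 := Finset.card_image_le (s := T.filter fun x => f x ≠ a) (f := f)
  have h3 := Finset.card_filter_add_card_filter_not (s := T) (fun x => f x = a)
  grind

theorem injOn_filter_ne_of_card_le
    (h : T.card + 1 ≤ (T.filter fun x => f x = a).card + (T.image f).card) :
    Set.InjOn f (T.filter fun x => f x ≠ a) := by
  have h1 := card_image_le_card_filter_ne T f a
  have h2 := Finset.card_image_le (s := T.filter fun x => f x ≠ a) (f := f)
  have h3 := Finset.card_filter_add_card_filter_not (s := T) (fun x => f x = a)
  refine Finset.card_image_iff.1 ?_
  grind

end Fibres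

/-- The edges of `G` are exactly the pairs of distinct elements of `C`. -/
def IsCliqueOn {V : Type*} (G : SimpleGraph V) (C : Finset V) : Prop :=
  ∀ x y, G.Adj x y ↔ x ≠ y ∧ x ∈ C ∧ y ∈ C

section CliqueUnion

variable {V : Type*} [Fintype V] {G : SimpleGraph V}

theorem graphSum_top_bot_adj {A B : Type*} {p q : A ⊕ B} :
    (graphSum (⊤ : SimpleGraph A) (⊥ : SimpleGraph B)).Adj p q ↔
      p ≠ q ∧ p.isLeft ∧ q.isLeft := by
  rcases p with a | a <;> rcases q with b | b <;>
    simp [graphSum, SimpleGraph.fromRel_adj, eq_comm]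

theorem nonempty_iso_graphSum_iff {k : ℕ} :
    Nonempty (G ≃g graphSum (⊤ : SimpleGraph (Fin k))
        (⊥ : SimpleGraph (Fin (Fintype.card V - k)))) ∧ k ≤ Fintype.card V ↔
      ∃ C : Finset V, C.card = k ∧ IsCliqueOn G C := by
  constructor
  · rintro ⟨⟨e⟩, -⟩
    refine ⟨Finset.univ.map (Function.Embedding.inl.trans e.symm.toEquiv.toEmbedding),
      by simp, fun x y => ?_⟩
    have hmem : ∀ x, (∃ i, e.symm (Sum.inl i) = x) ↔ (e x).isLeft := by
      intro x
      rw [Sum.isLeft_iff]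
      refine exists_congr fun i => ?_
      rw [RelIso.symm_apply_eq, eq_comm]
    rw [← e.map_adj_iff, graphSum_top_bot_adj, ← hmem, ← hmem]
    simp
  · rintro ⟨C, hC, hadj⟩
    have hle : k ≤ Fintype.card V := hC ▸ Finset.card_le_univ C
    refine ⟨⟨?_⟩, hle⟩
    let e₁ : {x // x ∈ C} ≃ Fin k := Fintype.equivFinOfCardEq (by simpa using hC)
    let e₂ : {x // x ∉ C} ≃ Fin (Fintype.card V - k) :=
      Fintype.equivFinOfCardEq (by rw [Fintype.card_subtype_compl]; simp [hC])
    let e : V ≃ Fin k ⊕ Fin (Fintype.card V - k) :=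
      (Equiv.sumCompl (· ∈ C)).symm.trans (Equiv.sumCongr e₁ e₂)
    have hleft : ∀ x, (e x).isLeft ↔ x ∈ C := by
      intro x
      by_cases hx : x ∈ C <;> simp [e, hx]
    refine ⟨e, ?_⟩
    intro x y
    rw [graphSum_top_bot_adj, hleft, hleft, hadj, e.injective.ne_iff]

theorem IsCliqueOn.le_alphaRadius {C : Finset V} (hC : IsCliqueOn G C) {k : ℕ}
    (hk : C.card = k + 1) (α : ℝ) : (α + 1) * k ≤ alphaRadius α G := by
  have hne : C.Nonempty := Finset.card_pos.1 (by omega)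
  obtain ⟨w, hw⟩ := hne
  refine le_specRad (v := fun x => if x ∈ C then 1 else 0)
    (Function.ne_iff.2 ⟨w, by simp [hw]⟩) (funext fun x => ?_)
  rw [alphaMat_mulVec, Pi.smul_apply, smul_eq_mul]
  by_cases hx : x ∈ C
  · have hN : G.neighborFinset x = C.erase x := by
      ext y
      simp [hC x y, hx, eq_comm]
    have hcard : (C.erase x).card = k := by rw [Finset.card_erase_of_mem hx]; omega
    have hsum : ∑ y ∈ C.erase x, (if y ∈ C then (1 : ℝ) else 0) = k := by
      rw [Finset.sum_congr rfl fun y hy => if_pos (Finset.mem_of_mem_erase hy)]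
      simp [hcard]
    rw [← SimpleGraph.card_neighborFinset_eq_degree, hN, hsum, hcard]
    simp [hx]
    ring
  · have hN : G.neighborFinset x = ∅ := by
      ext y
      simp [hC x y, hx]
    simp [hN, hx]

end CliqueUnion

section Barrier

variable {V ι : Type*} [Fintype V] {G : SimpleGraph V} {β : ℕ} {S : Finset V} {f : V → ι}

theorem card_barrier_le (hcard : Fintype.card V + S.card ≤ 2 * β + (Sᶜ.image f).card) :
    S.card ≤ β := by
  have h1 := Finset.card_image_le (s := Sᶜ) (f := f)
  have h2 := Finset.card_add_card_compl S
  omega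

theorem card_neighborFinset_sdiff_add_le
    (hf : ∀ x y, x ∉ S → y ∉ S → G.Adj x y → f x = f y)
    (hcard : Fintype.card V + S.card ≤ 2 * β + (Sᶜ.image f).card) {x : V} (hx : x ∉ S) :
    (G.neighborFinset x \ S).card + 2 * S.card ≤ 2 * β := by
  have h1 := card_fibre_add_card_image_le Sᶜ f (f x)
  have h2 := Finset.card_add_card_compl S
  have h3 : (insert x (G.neighborFinset x \ S)).card ≤ (Sᶜ.filter fun y => f y = f x).card := by
    refine Finset.card_le_card fun y hy => ?_
    rcases Finset.mem_insert.1 hy with rfl | hy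
    · simp [hx]
    · rw [Finset.mem_sdiff, SimpleGraph.mem_neighborFinset] at hy
      simp [hy.2, hf x y hx hy.2 hy.1]
  rw [Finset.card_insert_of_notMem (by simp)] at h3
  omega

theorem sum_neighborFinset_ite (a : ℝ) (x : V) :
    ∑ z ∈ G.neighborFinset x, (if z ∈ S then a else 1) =
      a * (G.neighborFinset x ∩ S).card + (G.neighborFinset x \ S).card := by
  rw [Finset.sum_ite, Finset.filter_mem_eq_inter, Finset.filter_notMem_eq_sdiff]
  simp [mul_comm]

theorem degree_eq_card_inter_add_card_sdiff (S : Finset V) (x : V) :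
    G.degree x = (G.neighborFinset x ∩ S).card + (G.neighborFinset x \ S).card := by
  rw [Finset.card_inter_add_card_sdiff, SimpleGraph.card_neighborFinset_eq_degree]

theorem alphaRadius_lt_of_barrier_nonempty {α : ℝ} (hα : 0 ≤ α)
    (hf : ∀ x y, x ∉ S → y ∉ S → G.Adj x y → f x = f y)
    (hcard : Fintype.card V + S.card ≤ 2 * β + (Sᶜ.image f).card) (hS : S.Nonempty)
    (hn : (Fintype.card V : ℝ) * (α + 1) < (2 * α + 3) * β + α + 2) :
    alphaRadius α G < 2 * (α + 1) * β := by
  have hs1 : (1 : ℝ) ≤ S.card := by exact_mod_cast hS.card_pos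
  have hsβ : (S.card : ℝ) ≤ β := by exact_mod_cast card_barrier_le hcard
  have hsn : (S.card : ℝ) ≤ Fintype.card V := by exact_mod_cast Finset.card_le_univ S
  set n : ℝ := (Fintype.card V : ℝ) with hn_def
  set s : ℝ := (S.card : ℝ) with hs_def
  set c : ℝ := 2 * (α + 1) * β - α * (n - 1) - (s - 1) with hc
  have hcn : n - s < c * (α + 2) := by
    have h1 : (n * (α + 1)) * (α + 1) < ((2 * α + 3) * β + α + 2) * (α + 1) :=
      mul_lt_mul_of_pos_right hn (by linarith)
    have h2 : (α + 1) * s ≤ (α + 1) * β := mul_le_mul_of_nonneg_left hsβ (by linarith)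
    rw [hc]
    nlinarith
  have hcpos : 0 < c := pos_of_mul_pos_left (by linarith : 0 < c * (α + 2)) (by linarith)
  obtain ⟨a, ha1, ha2⟩ := exists_between ((div_lt_iff₀' hcpos).2 hcn)
  rw [div_lt_iff₀' hcpos] at ha1
  have ha0 : 0 < a := pos_of_mul_pos_right (by linarith : 0 < c * a) hcpos.le
  have hβpos : (0 : ℝ) < β := by linarith
  refine alphaRadius_lt hα (by positivity) (y := fun x => if x ∈ S then a else 1)
    (fun x => by split_ifs <;> positivity) fun x => ?_
  have hdeg : (G.degree x : ℝ) =
      (G.neighborFinset x ∩ S).card + (G.neighborFinset x \ S).card := by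
    exact_mod_cast degree_eq_card_inter_add_card_sdiff S x
  rw [sum_neighborFinset_ite, hdeg]
  by_cases hx : x ∈ S
  · have h1 : ((G.neighborFinset x ∩ S).card : ℝ) ≤ s - 1 := by
      have : (G.neighborFinset x ∩ S).card < S.card :=
        Finset.card_lt_card ⟨Finset.inter_subset_right, fun h => by simpa using h hx⟩
      rw [le_sub_iff_add_le, hs_def]
      exact_mod_cast this
    have h2 : ((G.neighborFinset x \ S).card : ℝ) ≤ n - s := by
      have h3 : (G.neighborFinset x \ S).card ≤ Sᶜ.card :=
        Finset.card_le_card fun y hy => by simpa using (Finset.mem_sdiff.1 hy).2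
      have h4 := Finset.card_add_card_compl S
      rw [le_sub_iff_add_le, hs_def, hn_def]
      exact_mod_cast (by omega : (G.neighborFinset x \ S).card + S.card ≤ Fintype.card V)
    set p : ℝ := ((G.neighborFinset x ∩ S).card : ℝ)
    set q : ℝ := ((G.neighborFinset x \ S).card : ℝ)
    rw [if_pos hx]
    have h3 : α * (p + q) * a ≤ α * (n - 1) * a := by gcongr; linarith
    have h4 : a * p ≤ a * (s - 1) := by gcongr
    rw [hc] at ha1
    nlinarith
  · have h1 : ((G.neighborFinset x ∩ S).card : ℝ) ≤ s := by
      rw [hs_def]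
      exact_mod_cast Finset.card_le_card Finset.inter_subset_right
    have h2 : ((G.neighborFinset x \ S).card : ℝ) + 2 * s ≤ 2 * β := by
      rw [hs_def]
      exact_mod_cast card_neighborFinset_sdiff_add_le hf hcard hx
    set p : ℝ := ((G.neighborFinset x ∩ S).card : ℝ)
    set q : ℝ := ((G.neighborFinset x \ S).card : ℝ)
    rw [if_neg hx]
    have h3 : α * (p + q) ≤ α * (2 * β - s) := by gcongr; linarith
    have h4 : a * p ≤ a * s := by gcongr
    have h5 : a * s < (α + 2) * s := by gcongr
    nlinarith

/-- When the empty set is a barrier, a nonempty set of vertices of degree `2 * β` closed under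
adjacency forces `G` to be a clique on `2 * β + 1` vertices together with isolated vertices. -/
theorem exists_isCliqueOn_of_regular (hf : ∀ x y, G.Adj x y → f x = f y)
    (hcard : Fintype.card V ≤ 2 * β + (Finset.univ.image f).card) {C : Finset V}
    (hC : C.Nonempty) (hreg : ∀ x ∈ C, G.degree x = 2 * β)
    (hclosed : ∀ x ∈ C, ∀ y, G.Adj x y → y ∈ C) :
    ∃ F : Finset V, F.card = 2 * β + 1 ∧ IsCliqueOn G F := by
  obtain ⟨m, hm⟩ := hC
  set F := Finset.univ.filter fun y => f y = f m with hF
  have hFle := card_fibre_add_card_image_le Finset.univ f (f m)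
  rw [← hF, Finset.card_univ] at hFle
  have hins : ∀ x ∈ C, f x = f m → insert x (G.neighborFinset x) = F := by
    intro x hx hxm
    refine Finset.eq_of_subset_of_card_le (fun y hy => ?_) ?_
    · rcases Finset.mem_insert.1 hy with rfl | hy
      · simp [hF, hxm]
      · rw [SimpleGraph.mem_neighborFinset] at hy
        simp [hF, ← hf x y hy, hxm]
    · rw [Finset.card_insert_of_notMem (by simp), SimpleGraph.card_neighborFinset_eq_degree,
        hreg x hx]
      omega
  have hFm := hins m hm rfl
  have hFcard : F.card = 2 * β + 1 := by
    rw [← hFm, Finset.card_insert_of_notMem (by simp), SimpleGraph.card_neighborFinset_eq_degree,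
      hreg m hm]
  have hFC : ∀ x ∈ F, x ∈ C := by
    intro x hx
    rw [← hFm, Finset.mem_insert, SimpleGraph.mem_neighborFinset] at hx
    rcases hx with rfl | hx
    · exact hm
    · exact hclosed m hm x hx
  have hinj := injOn_filter_ne_of_card_le Finset.univ f (f m)
    (by rw [← hF, Finset.card_univ]; omega)
  refine ⟨F, hFcard, fun x y => ⟨fun hxy => ?_, fun ⟨hne, hx, hy⟩ => ?_⟩⟩
  · have hfxy := hf x y hxy
    have hxF : f x = f m := by
      by_contra hx
      exact hxy.ne (hinj (by simpa using hx) (by simpa [← hfxy] using hx) hfxy)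
    exact ⟨hxy.ne, by simp [hF, hxF], by simp [hF, ← hfxy, hxF]⟩
  · rw [← hins x (hFC x hx) (by simpa [hF] using hx), Finset.mem_insert,
      SimpleGraph.mem_neighborFinset] at hy
    exact hy.resolve_left hne.symm

end Barrier

theorem stmt1 (α : ℝ) (hα : 0 ≤ α) (n β : ℕ) (G : SimpleGraph (Fin n))
    (hβ : matchingNumber G = β) (h1 : 2 * β + 2 ≤ n)
    (h2 : (n : ℝ) < ((2 * α + 3) * β + α + 2) / (α + 1)) :
    alphaRadius α G ≤ 2 * (α + 1) * β ∧
      (alphaRadius α G = 2 * (α + 1) * β ↔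
        Nonempty (G ≃g graphSum (⊤ : SimpleGraph (Fin (2 * β + 1)))
          (⊥ : SimpleGraph (Fin (n - (2 * β + 1)))))) := by
  have hiso := nonempty_iso_graphSum_iff (G := G) (k := 2 * β + 1)
  rw [Fintype.card_fin, and_iff_left (by omega)] at hiso
  rw [hiso]
  have hge : (∃ C : Finset (Fin n), C.card = 2 * β + 1 ∧ IsCliqueOn G C) →
      2 * (α + 1) * β ≤ alphaRadius α G := by
    rintro ⟨C, hC, hclique⟩
    have := hclique.le_alphaRadius hC α
    push_cast at this
    linarith
  rw [lt_div_iff₀ (by linarith)] at h2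
  have hβpos : (0 : ℝ) < β := by
    have h3 : (2 * β + 2 : ℝ) ≤ n := by exact_mod_cast h1
    by_contra! h0
    have h4 : (β : ℝ) = 0 := le_antisymm h0 (Nat.cast_nonneg β)
    rw [h4] at h2 h3
    nlinarith
  obtain ⟨S, ι, f, hf, hcard⟩ := exists_barrier G (by simpa [hβ] using h1)
  rw [hβ] at hcard
  rcases S.eq_empty_or_nonempty with rfl | hS
  · have hdeg : ∀ x, G.degree x ≤ 2 * β := fun x => by
      simpa using card_neighborFinset_sdiff_add_le hf hcard (Finset.notMem_empty x)
    have hle : alphaRadius α G ≤ 2 * (α + 1) * β := by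
      refine alphaRadius_le hα (by positivity) (y := fun _ => 1) (fun _ => one_pos) fun x => ?_
      have h3 : (G.degree x : ℝ) ≤ 2 * β := by exact_mod_cast hdeg x
      simp
      nlinarith
    refine ⟨hle, fun heq => ?_, fun h => hle.antisymm (hge h)⟩
    obtain ⟨v, hv, hvt⟩ := exists_mulVec_eq_specRad_smul
      (M := α • degMat G + adjMat G) (by rw [← alphaRadius, heq]; positivity)
    rw [← alphaRadius, heq] at hvt
    obtain ⟨C, hC, hreg, hclosed⟩ := exists_regular_closed_finset hα hdeg hv
      (by rw [hvt]; push_cast; congr 1; ring)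
    exact exists_isCliqueOn_of_regular (fun x y => hf x y (by simp) (by simp))
      (by simpa using hcard) hC hreg hclosed
  · have hlt := alphaRadius_lt_of_barrier_nonempty hα hf hcard hS (by simpa using h2)
    exact ⟨hlt.le, fun h => absurd h hlt.ne, fun h => absurd (hge h) hlt.not_ge⟩
end

section
/- Let G be a simple graph on n vertices with matching number β, and let ρ(G) denote the largest eigenvalue of its adjacency matrix. If n > 3β + 2, then ρ(G) ≤ (β − 1 + √((β−1)² + 4β(n−β)))/2, with equality if and only if G is isomorphic to the join K_β ∨ K̄_{n−β}. -/
open scoped Classical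

namespace SimpleGraph

/-- The graph in which two distinct vertices are adjacent when at least one of them is in `S`. -/
def completeSplit {V : Type*} (S : Finset V) : SimpleGraph V where
  Adj i j := i ≠ j ∧ (i ∈ S ∨ j ∈ S)
  symm := ⟨fun _ _ h => ⟨h.1.symm, h.2.symm⟩⟩
  loopless := ⟨fun _ h => h.1 rfl⟩

theorem Subgraph.ncard_verts_le {V : Type*} [Fintype V] {G : SimpleGraph V} {M : G.Subgraph}
    (hM : M.IsMatching) : M.verts.ncard ≤ 2 * M.edgeSet.ncard := by
  have hsub : M.verts.toFinset ⊆ M.edgeSet.toFinset.biUnion Sym2.toFinset := by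
    intro v hv
    obtain ⟨w, hw, -⟩ := hM (by simpa using hv)
    simp only [Finset.mem_biUnion, Set.mem_toFinset, Sym2.mem_toFinset]
    exact ⟨s(v, w), by simpa using hw, by simp⟩
  rw [Set.ncard_eq_toFinset_card', Set.ncard_eq_toFinset_card', mul_comm]
  refine (Finset.card_le_card hsub).trans (Finset.card_biUnion_le_card_mul _ _ _ fun e _ => ?_)
  induction e with
  | _ a b => rw [Sym2.toFinset_mk_eq]; exact Finset.card_le_two

theorem ncard_edgeSet_le_matchingNumber {V : Type*} [Fintype V] {G : SimpleGraph V}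
    {M : G.Subgraph} (hM : M.IsMatching) : M.edgeSet.ncard ≤ matchingNumber G := by
  refine le_csSup ⟨Nat.card (Sym2 V), ?_⟩ ⟨M, hM, rfl⟩
  rintro m ⟨M', -, rfl⟩
  exact Set.ncard_le_card _

theorem Subgraph.IsMatching.exists_sup_edge {V : Type*} [Fintype V] {G : SimpleGraph V}
    {M : G.Subgraph} (hM : M.IsMatching) {v w : V} (h : G.Adj v w) (hv : v ∉ M.verts)
    (hw : w ∉ M.verts) :
    ∃ M' : G.Subgraph, M'.IsMatching ∧ M'.verts = M.verts ∪ {v, w} ∧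
      M'.edgeSet.ncard = M.edgeSet.ncard + 1 := by
  refine ⟨M ⊔ G.subgraphOfAdj h, hM.sup (Subgraph.IsMatching.subgraphOfAdj h) ?_, by simp, ?_⟩
  · rw [hM.support_eq_verts, support_subgraphOfAdj, Set.disjoint_right]
    rintro x (rfl | rfl) <;> assumption
  · rw [Subgraph.edgeSet_sup, edgeSet_subgraphOfAdj, Set.union_singleton,
      Set.ncard_insert_of_notMem]
    intro hmem
    exact hv (M.edge_vert (Subgraph.mem_edgeSet.1 hmem))

/-- Some set `S` of at most `β` vertices leaves a graph of maximum degree at most `2 (β - |S|)`,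
where `β` is the matching number. -/
theorem exists_card_le_matchingNumber {V : Type*} [Fintype V] (G : SimpleGraph V) :
    ∃ S : Finset V, S.card ≤ matchingNumber G ∧ ∀ v ∉ S,
      (Finset.univ.filter fun w => w ∉ S ∧ G.Adj v w).card ≤
        2 * (matchingNumber G - S.card) := by
  set P : Finset V → Prop := fun S => ∀ M : G.Subgraph, M.IsMatching → Disjoint M.verts (S : Set V) →
    M.edgeSet.ncard + S.card ≤ matchingNumber G with hP
  have hcard : ∀ S, P S → S.card ≤ matchingNumber G := by
    intro S hS
    have := hS ⊥ (by intro v hv; simp at hv) (by simp)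
    omega
  obtain ⟨S, hS, hmax⟩ := Finset.exists_max_image (Finset.univ.filter P) Finset.card
    ⟨∅, by simpa [hP] using fun M hM => ncard_edgeSet_le_matchingNumber hM⟩
  replace hS : P S := by simpa using hS
  refine ⟨S, hcard S hS, fun v hv => ?_⟩
  by_contra! hlt
  suffices hins : P (insert v S) by
    have := hmax (insert v S) (by simpa using hins)
    rw [Finset.card_insert_of_notMem hv] at this
    omega
  intro M hM hdis
  rw [Finset.coe_insert, Set.disjoint_insert_right] at hdis
  rw [Finset.card_insert_of_notMem hv]
  by_contra! hbig
  have h1 := hS M hM hdis.2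
  have h2 := Subgraph.ncard_verts_le hM
  obtain ⟨w, hw, hwM⟩ := Finset.exists_mem_notMem_of_card_lt_card
    (s := M.verts.toFinset) (t := Finset.univ.filter fun w => w ∉ S ∧ G.Adj v w) (by
      rw [← Set.ncard_eq_toFinset_card']; omega)
  simp only [Finset.mem_filter, Finset.mem_univ, true_and] at hw
  obtain ⟨M', hM', hverts, hedges⟩ := hM.exists_sup_edge hw.2 hdis.1 (by simpa using hwM)
  have h3 := hS M' hM' (by
    rw [hverts, Set.disjoint_union_left]
    refine ⟨hdis.2, Set.disjoint_left.2 ?_⟩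
    rintro x (rfl | rfl)
    · simpa using hv
    · simpa using hw.1)
  omega

theorem completeSplit_iso_graphJoin {n β : ℕ} {S : Finset (Fin n)} (hS : S.card = β) :
    Nonempty (completeSplit S ≃g graphJoin (⊤ : SimpleGraph (Fin β))
      (⊥ : SimpleGraph (Fin (n - β)))) := by
  let e₁ : {i // i ∈ S} ≃ Fin β := Fintype.equivFinOfCardEq (by simpa using hS)
  let e₂ : {i // i ∉ S} ≃ Fin (n - β) := Fintype.equivFinOfCardEq (by
    rw [Fintype.card_subtype_compl]; simp [hS])
  let e := (Equiv.sumCongr e₁ e₂).symm.trans (Equiv.sumCompl (· ∈ S))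
  refine ⟨RelIso.symm ⟨e, ?_⟩⟩
  rintro (a | a) (b | b)
  · have := (e₁.symm a).2
    simp [e, completeSplit, graphJoin, eq_comm]
  · have := (e₁.symm a).2
    have := (e₂.symm b).2
    have : (e₁.symm a : Fin n) ≠ e₂.symm b := by grind
    simp [e, completeSplit, graphJoin, this]
  · have := (e₁.symm b).2
    have := (e₂.symm a).2
    have : (e₂.symm a : Fin n) ≠ e₁.symm b := by grind
    simp [e, completeSplit, graphJoin, this]
  · simp [e, completeSplit, graphJoin, (e₂.symm a).2, (e₂.symm b).2]

theorem exists_eq_completeSplit {n β : ℕ} {G : SimpleGraph (Fin n)}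
    (φ : G ≃g graphJoin (⊤ : SimpleGraph (Fin β)) (⊥ : SimpleGraph (Fin (n - β)))) :
    ∃ S : Finset (Fin n), S.card = β ∧ G = completeSplit S := by
  set S : Finset (Fin n) :=
    Finset.univ.map (Function.Embedding.inl.trans φ.symm.toEquiv.toEmbedding) with hS
  have hmem : ∀ x, φ.symm x ∈ S ↔ x.isLeft := by
    intro x
    rw [hS, Finset.mem_map]
    constructor
    · rintro ⟨a, -, h⟩
      rw [← φ.symm.injective h]
      rfl
    · intro h
      obtain ⟨a, rfl⟩ := Sum.isLeft_iff.1 h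
      exact ⟨a, Finset.mem_univ a, rfl⟩
  refine ⟨S, by simp [hS], ?_⟩
  ext i j
  obtain ⟨a, rfl⟩ := φ.symm.surjective i
  obtain ⟨b, rfl⟩ := φ.symm.surjective j
  rw [φ.symm.map_adj_iff]
  simp only [completeSplit, hmem, ne_eq, φ.symm.injective.eq_iff]
  rcases a with a | a <;> rcases b with b | b <;> simp [graphJoin, eq_comm]

end SimpleGraph

section SpectralBounds

variable {V : Type*} [Fintype V] {A : Matrix V V ℝ}

theorem exists_mulVec_eq_specRad_smul_s7 [Nonempty V] (hA : A.IsHermitian) :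
    ∃ v : V → ℝ, v ≠ 0 ∧ A.mulVec v = specRad A • v := by
  have hset : {t : ℝ | ∃ v : V → ℝ, v ≠ 0 ∧ A.mulVec v = t • v} =
      {t | Module.End.HasEigenvalue (Matrix.toLin' A) t} := by
    ext t
    constructor
    · rintro ⟨v, hv, h⟩
      exact Module.End.hasEigenvalue_of_hasEigenvector
        ⟨Module.End.mem_eigenspace_iff.2 (by simpa using h), hv⟩
    · intro h
      obtain ⟨v, hv⟩ := h.exists_hasEigenvector
      exact ⟨v, hv.2, by simpa using hv.apply_eq_smul⟩
  have hfin : {t : ℝ | ∃ v : V → ℝ, v ≠ 0 ∧ A.mulVec v = t • v}.Finite :=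
    hset ▸ Module.End.finite_hasEigenvalue _
  obtain ⟨i⟩ := ‹Nonempty V›
  have hne : {t : ℝ | ∃ v : V → ℝ, v ≠ 0 ∧ A.mulVec v = t • v}.Nonempty := by
    refine ⟨hA.eigenvalues i, WithLp.ofLp (hA.eigenvectorBasis i), fun h0 => ?_,
      hA.mulVec_eigenvectorBasis i⟩
    exact hA.eigenvectorBasis.orthonormal.ne_zero i (by ext j; exact congrFun h0 j)
  exact hne.csSup_mem hfin

theorem smul_abs_le_mulVec_abs (hA : ∀ i j, 0 ≤ A i j) {t : ℝ} {v : V → ℝ}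
    (hv : A.mulVec v = t • v) (i : V) : t * |v i| ≤ A.mulVec (fun j => |v j|) i := by
  calc t * |v i| ≤ |t * v i| := by rw [abs_mul]; gcongr; exact le_abs_self t
    _ = |∑ j, A i j * v j| := by
        rw [← smul_eq_mul, ← Pi.smul_apply, ← hv]; rfl
    _ ≤ ∑ j, |A i j * v j| := Finset.abs_sum_le_sum_abs _ _
    _ = A.mulVec (fun j => |v j|) i := by
        simp only [Matrix.mulVec, dotProduct, abs_mul, abs_of_nonneg (hA _ _)]

theorem sum_mul_mulVec_comm (hA : A.IsSymm) (y v : V → ℝ) :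
    ∑ i, y i * A.mulVec v i = ∑ i, A.mulVec y i * v i := by
  change y ⬝ᵥ A.mulVec v = A.mulVec y ⬝ᵥ v
  rw [Matrix.dotProduct_mulVec, ← Matrix.mulVec_transpose, hA.eq]

theorem sum_mul_abs_pos {y v : V → ℝ} (hy : ∀ i, 0 < y i) (hv : v ≠ 0) :
    0 < ∑ i, y i * |v i| := by
  obtain ⟨i, hi⟩ := Function.ne_iff.1 hv
  exact Finset.sum_pos' (fun j _ => mul_nonneg (hy j).le (abs_nonneg _))
    ⟨i, Finset.mem_univ _, mul_pos (hy i) (abs_pos.2 hi)⟩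

theorem eigenvalue_le_of_mulVec_le (hA : A.IsSymm) (hA0 : ∀ i j, 0 ≤ A i j) {y v : V → ℝ} {r t : ℝ}
    (hy : ∀ i, 0 < y i) (hle : ∀ i, A.mulVec y i ≤ r * y i) (hv : v ≠ 0)
    (htv : A.mulVec v = t • v) : t ≤ r := by
  refine le_of_mul_le_mul_right ?_ (sum_mul_abs_pos hy hv)
  calc t * ∑ i, y i * |v i| = ∑ i, y i * (t * |v i|) := by
        rw [Finset.mul_sum]; exact Finset.sum_congr rfl fun i _ => by ring
    _ ≤ ∑ i, y i * A.mulVec (fun j => |v j|) i :=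
        Finset.sum_le_sum fun i _ =>
          mul_le_mul_of_nonneg_left (smul_abs_le_mulVec_abs hA0 htv i) (hy i).le
    _ = ∑ i, A.mulVec y i * |v i| := sum_mul_mulVec_comm hA _ _
    _ ≤ ∑ i, r * y i * |v i| :=
        Finset.sum_le_sum fun i _ => mul_le_mul_of_nonneg_right (hle i) (abs_nonneg _)
    _ = r * ∑ i, y i * |v i| := by
        rw [Finset.mul_sum]; exact Finset.sum_congr rfl fun i _ => by ring

theorem mulVec_eq_of_eigenvalue_eq (hA : A.IsSymm) (hA0 : ∀ i j, 0 ≤ A i j) {y v : V → ℝ} {r : ℝ}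
    (hy : ∀ i, 0 < y i) (hle : ∀ i, A.mulVec y i ≤ r * y i) (hrv : A.mulVec v = r • v) (i : V) :
    A.mulVec (fun j => |v j|) i = r * |v i| ∧ (v i ≠ 0 → A.mulVec y i = r * y i) := by
  have h1 : ∀ i ∈ Finset.univ, y i * (r * |v i|) ≤ y i * A.mulVec (fun j => |v j|) i :=
    fun i _ => mul_le_mul_of_nonneg_left (smul_abs_le_mulVec_abs hA0 hrv i) (hy i).le
  have h2 : ∀ i ∈ Finset.univ, A.mulVec y i * |v i| ≤ r * y i * |v i| :=
    fun i _ => mul_le_mul_of_nonneg_right (hle i) (abs_nonneg _)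
  have h3 := sum_mul_mulVec_comm hA y fun j => |v j|
  have h4 : ∑ i, y i * (r * |v i|) = ∑ i, r * y i * |v i| :=
    Finset.sum_congr rfl fun i _ => by ring
  have h5 := Finset.sum_le_sum h1
  have h6 := Finset.sum_le_sum h2
  have h7 := (Finset.sum_eq_sum_iff_of_le h1).1 (by linarith) i (Finset.mem_univ i)
  have h8 := (Finset.sum_eq_sum_iff_of_le h2).1 (by linarith) i (Finset.mem_univ i)
  exact ⟨(mul_left_cancel₀ (hy i).ne' h7).symm,
    fun hvi => mul_right_cancel₀ (abs_pos.2 hvi).ne' h8⟩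

theorem specRad_le_of_mulVec_le [Nonempty V] (hA : A.IsSymm) (hA0 : ∀ i j, 0 ≤ A i j) {y : V → ℝ}
    {r : ℝ} (hy : ∀ i, 0 < y i) (hle : ∀ i, A.mulVec y i ≤ r * y i) : specRad A ≤ r := by
  obtain ⟨v, hv, hA'⟩ := exists_mulVec_eq_specRad_smul_s7 (by simpa [Matrix.IsHermitian] using hA.eq)
  exact eigenvalue_le_of_mulVec_le hA hA0 hy hle hv hA'

theorem specRad_lt_of_mulVec_lt [Nonempty V] (hA : A.IsSymm) (hA0 : ∀ i j, 0 ≤ A i j) {y : V → ℝ}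
    {r : ℝ} (hy : ∀ i, 0 < y i) (hlt : ∀ i, A.mulVec y i < r * y i) : specRad A < r := by
  refine lt_of_le_of_ne (specRad_le_of_mulVec_le hA hA0 hy fun i => (hlt i).le) fun heq => ?_
  obtain ⟨v, hv, hA'⟩ := exists_mulVec_eq_specRad_smul_s7 (by simpa [Matrix.IsHermitian] using hA.eq)
  obtain ⟨i, hi⟩ := Function.ne_iff.1 hv
  exact (hlt i).ne ((mulVec_eq_of_eigenvalue_eq hA hA0 hy (fun i => (hlt i).le)
    (heq ▸ hA') i).2 hi)

theorem specRad_eq_of_mulVec_eq [Nonempty V] (hA : A.IsSymm) (hA0 : ∀ i j, 0 ≤ A i j) {y : V → ℝ}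
    {r : ℝ} (hy : ∀ i, 0 < y i) (heq : A.mulVec y = r • y) : specRad A = r := by
  have hle : ∀ i, A.mulVec y i ≤ r * y i := fun i => by simp [heq]
  refine le_antisymm (specRad_le_of_mulVec_le hA hA0 hy hle) (le_csSup ⟨r, ?_⟩ ⟨y, ?_, heq⟩)
  · rintro t ⟨v, hv, h⟩
    exact eigenvalue_le_of_mulVec_le hA hA0 hy hle hv h
  · intro h0
    obtain ⟨i⟩ := ‹Nonempty V›
    exact (hy i).ne' (congrFun h0 i)

end SpectralBounds

/-- The vector equal to `1` on `S` and to `c` elsewhere. -/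
noncomputable def twoValued {V : Type*} (S : Finset V) (c : ℝ) (i : V) : ℝ := if i ∈ S then 1 else c

theorem twoValued_pos {V : Type*} (S : Finset V) {c : ℝ} (hc : 0 < c) (i : V) : 0 < twoValued S c i := by
  unfold twoValued; split_ifs <;> positivity

theorem sum_twoValued {V : Type*} (S T : Finset V) (c : ℝ) :
    ∑ i ∈ T, twoValued S c i =
      (T.filter (· ∈ S)).card + (T.filter (· ∉ S)).card * c := by
  simp [twoValued, Finset.sum_ite]

section AdjMat

variable {V : Type*} [Fintype V] {G : SimpleGraph V}

theorem adjMat_isSymm (G : SimpleGraph V) : (adjMat G).IsSymm := by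
  ext i j
  simp [adjMat, G.adj_comm]

theorem adjMat_nonneg (G : SimpleGraph V) (i j : V) : 0 ≤ adjMat G i j := by
  unfold adjMat; split_ifs <;> norm_num

theorem adjMat_mulVec (G : SimpleGraph V) (y : V → ℝ) (i : V) :
    (adjMat G).mulVec y i = ∑ j with G.Adj i j, y j := by
  simp [Matrix.mulVec, dotProduct, adjMat, Finset.sum_filter]

theorem completeSplit_mulVec_of_mem {S : Finset V} (c : ℝ) {i : V} (hi : i ∈ S) :
    (adjMat (SimpleGraph.completeSplit S)).mulVec (twoValued S c) i =
      (S.card : ℝ) - 1 + ((Fintype.card V : ℝ) - S.card) * c := by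
  have h : Finset.univ.filter ((SimpleGraph.completeSplit S).Adj i) = Finset.univ.erase i := by
    ext j; simp [SimpleGraph.completeSplit, hi, eq_comm]
  rw [adjMat_mulVec, h]
  have h1 := Finset.add_sum_erase Finset.univ (twoValued S c) (Finset.mem_univ i)
  have h2 : (Finset.univ.filter (· ∉ S)).card + S.card = Fintype.card V := by
    have := Finset.card_filter_add_card_filter_not (s := Finset.univ) (· ∈ S)
    simp only [Finset.filter_univ_mem, Finset.card_univ] at this
    omega
  have h3 : twoValued S c i = 1 := if_pos hi
  have h2' : ((Finset.univ.filter (· ∉ S)).card : ℝ) = Fintype.card V - S.card := by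
    rw [← h2]; push_cast; ring
  rw [h3, sum_twoValued S Finset.univ, h2'] at h1
  simp only [Finset.filter_univ_mem] at h1
  linarith

theorem completeSplit_mulVec_of_notMem {S : Finset V} (c : ℝ) {i : V} (hi : i ∉ S) :
    (adjMat (SimpleGraph.completeSplit S)).mulVec (twoValued S c) i = S.card := by
  have h : Finset.univ.filter ((SimpleGraph.completeSplit S).Adj i) = S := by
    ext j
    simp only [SimpleGraph.completeSplit, hi, Finset.mem_filter, Finset.mem_univ, true_and,
      false_or]
    exact ⟨fun h => h.2, fun h => ⟨fun hij => hi (hij ▸ h), h⟩⟩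
  rw [adjMat_mulVec, h, sum_twoValued]
  simp

theorem adjMat_mulVec_mono {H : SimpleGraph V} (hGH : G ≤ H) {y : V → ℝ} (hy : ∀ i, 0 < y i)
    (i : V) : (adjMat G).mulVec y i ≤ (adjMat H).mulVec y i := by
  rw [adjMat_mulVec, adjMat_mulVec]
  exact Finset.sum_le_sum_of_subset_of_nonneg
    (Finset.monotone_filter_right _ fun j _ h => hGH h) fun j _ _ => (hy j).le

theorem adj_of_adjMat_mulVec_eq {H : SimpleGraph V} (hGH : G ≤ H) {y : V → ℝ}
    (hy : ∀ i, 0 < y i) {i : V} (heq : (adjMat G).mulVec y i = (adjMat H).mulVec y i) {j : V}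
    (hij : H.Adj i j) : G.Adj i j := by
  by_contra hG
  refine heq.not_lt ?_
  rw [adjMat_mulVec, adjMat_mulVec]
  exact Finset.sum_lt_sum_of_subset (Finset.monotone_filter_right _ fun j _ h => hGH h)
    (by simpa using hij) (by simpa using hG) (hy j) fun j _ _ => (hy j).le

/-- A subgraph of a complete split graph with the same spectral radius is the whole graph. -/
theorem eq_completeSplit_of_specRad_eq [Nonempty V] {S : Finset V}
    (hle : G ≤ SimpleGraph.completeSplit S) {c r : ℝ} (hc : 0 < c)
    (hS : S.Nonempty)
    (heig : (adjMat (SimpleGraph.completeSplit S)).mulVec (twoValued S c) = r • twoValued S c)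
    (hG : specRad (adjMat G) = r) : G = SimpleGraph.completeSplit S := by
  have hy := twoValued_pos S hc
  have heig' : ∀ i, (adjMat (SimpleGraph.completeSplit S)).mulVec (twoValued S c) i =
      r * twoValued S c i := fun i => congrFun heig i
  obtain ⟨v, hv, hGv⟩ := exists_mulVec_eq_specRad_smul_s7 (A := adjMat G)
    (by simpa [Matrix.IsHermitian] using (adjMat_isSymm G).eq)
  rw [hG] at hGv
  have key := mulVec_eq_of_eigenvalue_eq (adjMat_isSymm G) (adjMat_nonneg G) hy
    (fun i => heig' i ▸ adjMat_mulVec_mono hle hy i) hGv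
  have hadj : ∀ i j, v i ≠ 0 → (SimpleGraph.completeSplit S).Adj i j → G.Adj i j := fun i j hi h =>
    adj_of_adjMat_mulVec_eq hle hy (((key i).2 hi).trans (heig' i).symm) h
  have hprop : ∀ i j, v i ≠ 0 → G.Adj i j → v j ≠ 0 := by
    intro i j hi hij
    have h1 := (key j).1
    rw [adjMat_mulVec] at h1
    have h2 : |v i| ≤ ∑ k with G.Adj j k, |v k| :=
      Finset.single_le_sum (f := fun k => |v k|) (fun k _ => abs_nonneg _)
        (by simpa using hij.symm)
    have h3 := abs_pos.2 hi
    intro h0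
    rw [h0] at h1
    simp only [abs_zero, mul_zero] at h1
    linarith
  obtain ⟨u, hu, hvu⟩ : ∃ u ∈ S, v u ≠ 0 := by
    obtain ⟨i, hi⟩ := Function.ne_iff.1 hv
    by_cases hiS : i ∈ S
    · exact ⟨i, hiS, hi⟩
    · obtain ⟨u, hu⟩ := hS
      exact ⟨u, hu, hprop i u hi (hadj i u hi ⟨fun h => hiS (h ▸ hu), Or.inr hu⟩)⟩
  have hall : ∀ i, v i ≠ 0 := by
    intro i
    by_cases hui : u = i
    · exact hui ▸ hvu
    · exact hprop u i hvu (hadj u i hvu ⟨hui, Or.inl hu⟩)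
  exact le_antisymm hle fun i j h => hadj i j (hall i) h

/-- A spectral bound from a vertex set whose deletion leaves small maximum degree. -/
theorem specRad_lt_of_degree_le [Nonempty V] {S : Finset V} {c r T : ℝ} (hc : 0 < c)
    (hdeg : ∀ v ∉ S, ((Finset.univ.filter fun w => w ∉ S ∧ G.Adj v w).card : ℝ) ≤ T)
    (hin : (S.card : ℝ) - 1 + ((Fintype.card V : ℝ) - S.card) * c < r)
    (hout : S.card + T * c < r * c) : specRad (adjMat G) < r := by
  have hy := twoValued_pos S hc
  refine specRad_lt_of_mulVec_lt (adjMat_isSymm G) (adjMat_nonneg G) hy fun i => ?_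
  by_cases hi : i ∈ S
  · have hGi : (adjMat G).mulVec (twoValued S c) i ≤
        (adjMat (SimpleGraph.completeSplit S)).mulVec (twoValued S c) i := by
      rw [adjMat_mulVec, adjMat_mulVec]
      exact Finset.sum_le_sum_of_subset_of_nonneg
        (Finset.monotone_filter_right _ fun j _ h => ⟨h.ne, Or.inl hi⟩) fun j _ _ => (hy j).le
    rw [completeSplit_mulVec_of_mem c hi] at hGi
    have : twoValued S c i = 1 := if_pos hi
    rw [this, mul_one]
    exact hGi.trans_lt hin
  · have : twoValued S c i = c := if_neg hi
    rw [this, adjMat_mulVec, sum_twoValued]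
    refine lt_of_le_of_lt ?_ hout
    refine add_le_add ?_ (mul_le_mul_of_nonneg_right ?_ hc.le)
    · exact_mod_cast Finset.card_le_card fun j hj => (Finset.mem_filter.1 hj).2
    · refine le_trans (le_of_eq ?_) (hdeg i hi)
      rw [Finset.filter_filter]
      simp only [and_comm]

end AdjMat

/-- The larger root of `x ^ 2 = (b - 1) * x + b * N`, for `N` large with respect to `b`. -/
theorem quadratic_root_properties {b N r : ℝ} (hb : 1 ≤ b) (hN : 2 * b + 3 ≤ N)
    (hr : r = (b - 1 + Real.sqrt ((b - 1) ^ 2 + 4 * b * N)) / 2) :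
    r ^ 2 = (b - 1) * r + b * N ∧ 2 * b < r ∧ r < N - 2 := by
  have hD : 0 ≤ (b - 1) ^ 2 + 4 * b * N := by nlinarith [sq_nonneg (b - 1)]
  have hs := Real.sq_sqrt hD
  have hs0 := Real.sqrt_nonneg ((b - 1) ^ 2 + 4 * b * N)
  have hsr : Real.sqrt ((b - 1) ^ 2 + 4 * b * N) = 2 * r - (b - 1) := by rw [hr]; ring
  rw [hsr] at hs hs0
  have hq : r ^ 2 = (b - 1) * r + b * N := by nlinarith
  refine ⟨hq, ?_, ?_⟩
  · by_contra! h
    nlinarith [mul_nonneg (sub_nonneg.2 h) (by linarith : 0 ≤ b + 1 + r)]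
  · by_contra! h
    nlinarith [mul_nonneg (sub_nonneg.2 h) (by linarith : 0 ≤ r + (N - 2) - (b - 1)),
      mul_nonneg (sub_nonneg.2 hN) (by linarith : 0 ≤ N)]

theorem exists_weight {b N r s : ℝ} (hb : 1 ≤ b)
    (hq : r ^ 2 = (b - 1) * r + b * N) (hr : 2 * b < r) (hrN : r < N - 2) (hs : 0 ≤ s)
    (hsb : s < b) :
    ∃ c : ℝ, 0 < c ∧ s - 1 + (b + N - s) * c < r ∧ s + 2 * (b - s) * c < r * c := by
  have h1 : 0 < r - 2 * (b - s) := by linarith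
  have h2 : 0 < b + N - s := by linarith
  have h3 : s / (r - 2 * (b - s)) < (r - s + 1) / (b + N - s) := by
    rw [div_lt_div_iff₀ h1 h2]
    nlinarith [mul_pos (sub_pos.2 hsb) (by linarith : 0 < N - 2 + s - r)]
  obtain ⟨c, hc1, hc2⟩ := exists_between h3
  rw [div_lt_iff₀ h1] at hc1
  rw [lt_div_iff₀ h2] at hc2
  refine ⟨c, ?_, by linarith, by linarith⟩
  by_contra! hc
  nlinarith

theorem completeSplit_eigenvector {V : Type*} [Fintype V] {S : Finset V} {c r : ℝ}
    (hin : S.Nonempty → (S.card : ℝ) - 1 + ((Fintype.card V : ℝ) - S.card) * c = r)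
    (hout : (S.card : ℝ) = r * c) :
    (adjMat (SimpleGraph.completeSplit S)).mulVec (twoValued S c) = r • twoValued S c := by
  ext i
  by_cases hi : i ∈ S
  · rw [completeSplit_mulVec_of_mem c hi, hin ⟨i, hi⟩]
    simp [twoValued, hi]
  · rw [completeSplit_mulVec_of_notMem c hi, hout]
    simp [twoValued, hi]

theorem stmt7 (n β : ℕ) (G : SimpleGraph (Fin n))
    (hβ : matchingNumber G = β) (h2 : n > 3 * β + 2) :
    specRad (adjMat G) ≤
      ((β : ℝ) - 1 + Real.sqrt (((β : ℝ) - 1) ^ 2 + 4 * β * ((n : ℝ) - β))) / 2 ∧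
      (specRad (adjMat G) =
        ((β : ℝ) - 1 + Real.sqrt (((β : ℝ) - 1) ^ 2 + 4 * β * ((n : ℝ) - β))) / 2 ↔
        Nonempty (G ≃g graphJoin (⊤ : SimpleGraph (Fin β))
          (⊥ : SimpleGraph (Fin (n - β))))) := by
  have : Nonempty (Fin n) := ⟨⟨0, by omega⟩⟩
  obtain ⟨r, hr⟩ : ∃ r, r =
    ((β : ℝ) - 1 + Real.sqrt (((β : ℝ) - 1) ^ 2 + 4 * β * ((n : ℝ) - β))) / 2 := ⟨_, rfl⟩
  rw [← hr]
  have hN : 2 * (β : ℝ) + 3 ≤ n - β := by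
    have : (3 * β + 3 : ℝ) ≤ n := by exact_mod_cast h2
    linarith
  obtain ⟨c, hc, heig⟩ : ∃ c : ℝ, 0 < c ∧ ∀ S : Finset (Fin n), S.card = β →
      (adjMat (SimpleGraph.completeSplit S)).mulVec (twoValued S c) = r • twoValued S c := by
    rcases Nat.eq_zero_or_pos β with rfl | hpos
    · have hr0 : r = 0 := by rw [hr]; norm_num
      refine ⟨1, one_pos, fun S hS => completeSplit_eigenvector ?_ (by simp [hS, hr0])⟩
      rw [Finset.card_eq_zero.1 hS]
      simp
    · obtain ⟨hq, hbr, -⟩ := quadratic_root_properties (by exact_mod_cast hpos) hN hr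
      have hb : (0 : ℝ) < β := by exact_mod_cast hpos
      have hr0 : 0 < r := by linarith
      refine ⟨β / r, by positivity, fun S hS => completeSplit_eigenvector (fun _ => ?_) ?_⟩
      · rw [hS, Fintype.card_fin]
        field_simp
        linarith
      · rw [hS]; field_simp
  have hsplit : ∀ S : Finset (Fin n), S.card = β →
      specRad (adjMat (SimpleGraph.completeSplit S)) = r := fun S hS =>
    specRad_eq_of_mulVec_eq (adjMat_isSymm _) (adjMat_nonneg _) (twoValued_pos S hc) (heig S hS)
  have hconv : Nonempty (G ≃g graphJoin (⊤ : SimpleGraph (Fin β))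
      (⊥ : SimpleGraph (Fin (n - β)))) → specRad (adjMat G) = r := by
    rintro ⟨φ⟩
    obtain ⟨S, hS, rfl⟩ := SimpleGraph.exists_eq_completeSplit φ
    exact hsplit S hS
  obtain ⟨S, hSβ, hdeg⟩ := G.exists_card_le_matchingNumber
  rw [hβ] at hSβ hdeg
  rcases hSβ.lt_or_eq with hlt | hS
  · have hb : (1 : ℝ) ≤ β := by exact_mod_cast (by omega : 1 ≤ β)
    obtain ⟨hq, hbr, hrN⟩ := quadratic_root_properties hb hN hr
    obtain ⟨w, hw, hin, hout⟩ := exists_weight hb hq hbr hrN (Nat.cast_nonneg S.card)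
      (by exact_mod_cast hlt)
    have hlt' : specRad (adjMat G) < r := by
      refine specRad_lt_of_degree_le hw (fun v hv => ?_) ?_ hout
      · rw [← Nat.cast_sub hSβ]
        exact_mod_cast hdeg v hv
      · rw [Fintype.card_fin]
        linarith
    exact ⟨hlt'.le, fun h => absurd h hlt'.ne, hconv⟩
  · have hle : G ≤ SimpleGraph.completeSplit S := by
      intro i j hij
      refine ⟨hij.ne, ?_⟩
      by_contra! hout
      have h0 := hdeg i hout.1
      rw [hS, Nat.sub_self, mul_zero, Nat.le_zero, Finset.card_eq_zero] at h0
      have : j ∈ (∅ : Finset (Fin n)) := h0 ▸ by simp [hout.2, hij]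
      simp at this
    have hy := twoValued_pos S hc
    refine ⟨specRad_le_of_mulVec_le (adjMat_isSymm G) (adjMat_nonneg G) hy fun i => ?_, ?_, hconv⟩
    · exact (adjMat_mulVec_mono hle hy i).trans (congrFun (heig S hS) i).le
    · intro heq
      suffices h : G = SimpleGraph.completeSplit S from
        h ▸ SimpleGraph.completeSplit_iso_graphJoin hS
      rcases Nat.eq_zero_or_pos β with rfl | hpos
      · refine le_antisymm hle fun i j h => ?_
        rw [Finset.card_eq_zero.1 hS] at h
        simp [SimpleGraph.completeSplit] at h
      · exact eq_completeSplit_of_specRad_eq hle hc (Finset.card_pos.1 (hS ▸ hpos)) (heig S hS) heq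
end
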